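/- Let S be a compact metric space and θ a Borel probability measure on S. There exists exactly one Borel probability measure π on S that is stationary for the kernel K^{θ,1,2}, i.e. satisfying π(A) = ∫_S K^{θ,1,2}(x,A) π(dx) for every Borel set A ⊆ S. -/

import Mathlib

open MeasureTheory
open scoped ENNReal

/-- The transition kernel `K^{θ,1,2}(x,A)`: step to the nearer of two i.i.d. `θ`-samples,
ties broken uniformly. -/
noncomputable def K12 {S : Type*} [MetricSpace S] [MeasurableSpace S]
    (θ : Measure S) (x : S) (A : Set S) : ℝ≥0∞ :=
  ∫⁻ y in A, (2 * θ {z | dist x y < dist x z} + θ {z | dist x z = dist x y}) ∂θ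

open ProbabilityTheory

section Doeblin

variable {α : Type*} [MeasurableSpace α]

/-- Doeblin's theorem: a Markov kernel that dominates a fixed nonzero measure has exactly one
invariant probability measure. -/
theorem existsUnique_invariant_of_minorization [Nonempty α] (κ : Kernel α α) [IsMarkovKernel κ]
    (ν : Measure α) (hν : ν ≠ 0) (hle : ∀ x, ν ≤ κ x) :
    ∃! π : Measure α, IsProbabilityMeasure π ∧ κ.Invariant π := by
  obtain ⟨x₀⟩ := ‹Nonempty α›
  have hν1 : ν Set.univ ≤ 1 := by simpa using hle x₀ Set.univ
  have : IsFiniteMeasure ν := ⟨hν1.trans_lt ENNReal.one_lt_top⟩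
  set r : ℝ≥0∞ := 1 - ν Set.univ with hr
  let R : Kernel α α := ⟨fun x => κ x - ν, by
    refine Measure.measurable_of_measurable_coe _ fun s hs => ?_
    simp_rw [Measure.sub_apply hs (hle _)]
    exact (κ.measurable_coe hs).sub_const _⟩
  have hRx : ∀ x, R x = κ x - ν := fun x => rfl
  have hR : κ = Kernel.const α ν + R := by
    ext1 x
    rw [_root_.add_apply, hRx, Kernel.const_apply, add_comm, Measure.sub_add_cancel_of_le (hle x)]
  have hmass : ∀ μ : Measure α, (R ∘ₘ μ) Set.univ = r * μ Set.univ := fun μ => by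
    rw [Measure.bind_apply MeasurableSet.univ R.measurable.aemeasurable]
    simp [hRx, Measure.sub_apply MeasurableSet.univ (hle _), hr]
  have hsplit : ∀ μ : Measure α, κ ∘ₘ μ = μ Set.univ • ν + R ∘ₘ μ := fun μ => by
    conv_lhs => rw [hR]
    rw [Measure.add_comp, Measure.const_comp]
  let T : ℕ → Measure α := fun n => (fun μ => R ∘ₘ μ)^[n] ν
  have hT0 : T 0 = ν := rfl
  have hTs : ∀ n, T (n + 1) = R ∘ₘ T n := fun n => Function.iterate_succ_apply' _ _ _
  have hTmass : ∀ n, T n Set.univ = r ^ n * ν Set.univ := fun n => by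
    induction n with
    | zero => simp [hT0]
    | succ n ih => rw [hTs, hmass, ih, pow_succ']; ring
  have hσmass : Measure.sum T Set.univ = 1 := by
    rw [Measure.sum_apply _ MeasurableSet.univ]
    simp_rw [hTmass]
    rw [ENNReal.tsum_mul_right, ENNReal.tsum_geometric, hr,
      ENNReal.sub_sub_cancel ENNReal.one_ne_top hν1]
    exact ENNReal.inv_mul_cancel (by simpa using hν) (measure_ne_top _ _)
  have hσprob : IsProbabilityMeasure (Measure.sum T) := ⟨hσmass⟩
  refine ⟨Measure.sum T, ⟨hσprob, ?_⟩, ?_⟩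
  · rw [Kernel.Invariant, hsplit, hσmass, one_smul, Measure.bind_sum _ _ R.measurable.aemeasurable]
    ext s hs
    rw [Measure.add_apply, Measure.sum_apply _ hs, Measure.sum_apply _ hs,
      tsum_eq_zero_add' (f := fun n => T n s) ENNReal.summable, hT0]
    simp only [hTs]
    rfl
  · rintro π ⟨hπ, hinv⟩
    have hπ' : π = ν + R ∘ₘ π := by
      conv_lhs => rw [← hinv.def, hsplit, measure_univ, one_smul]
    have hpart : ∀ n, ∑ k ∈ Finset.range n, T k ≤ π := fun n => by
      induction n with
      | zero => simpa using Measure.zero_le π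
      | succ n ih =>
        have hsum : ∑ k ∈ Finset.range (n + 1), T k
            = ν + R ∘ₘ (∑ k ∈ Finset.range n, T k) := by
          clear ih
          induction n with
          | zero => simp [hT0]
          | succ n ih =>
            rw [Finset.sum_range_succ _ (n + 1), Finset.sum_range_succ _ n, Measure.comp_add, ← hTs,
              ← add_assoc, ← ih, Finset.sum_range_succ _ n]
        rw [hsum, hπ']
        refine add_le_add le_rfl (Measure.le_iff.2 fun s hs => ?_)
        rw [Measure.bind_apply hs R.measurable.aemeasurable,
          Measure.bind_apply hs R.measurable.aemeasurable]
        exact lintegral_mono' ih le_rfl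
    refine (Measure.eq_of_le_of_measure_univ_eq (μ := Measure.sum T) (ν := π) ?_ (by simp)).symm
    refine Measure.le_iff.2 fun s hs => ?_
    rw [Measure.sum_apply _ hs, ENNReal.tsum_eq_iSup_nat]
    refine iSup_le fun n => ?_
    simpa using hpart n s

/-- A Markov kernel whose square satisfies a Doeblin minorization has exactly one invariant
probability measure. -/
theorem existsUnique_invariant_of_comp_self_minorization [Nonempty α] (κ : Kernel α α)
    [IsMarkovKernel κ] (ν : Measure α) (hν : ν ≠ 0) (hle : ∀ x, ν ≤ (κ ∘ₖ κ) x) :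
    ∃! π : Measure α, IsProbabilityMeasure π ∧ κ.Invariant π := by
  obtain ⟨π, ⟨hπ, hinv⟩, huniq⟩ := existsUnique_invariant_of_minorization (κ ∘ₖ κ) ν hν hle
  refine ⟨π, ⟨hπ, ?_⟩, fun π' ⟨hπ', hinv'⟩ => huniq π' ⟨hπ', hinv'.comp hinv'⟩⟩
  refine huniq _ ⟨⟨by rw [Measure.comp_apply_univ, measure_univ]⟩, ?_⟩
  rw [Kernel.Invariant, ← Measure.comp_assoc, Measure.comp_assoc (μ := π), hinv.def]

end Doeblin

section Nearer

/-- Drawing two independent samples and keeping the one with the smaller value of `f`, ties broken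
uniformly, has total mass `μ univ * μ univ`. -/
theorem lintegral_two_mul_measure_lt_add_measure_eq {α : Type*} [MeasurableSpace α]
    (μ : Measure α) [SFinite μ] {f : α → ℝ} (hf : Measurable f) :
    ∫⁻ y, (2 * μ {z | f y < f z} + μ {z | f z = f y}) ∂μ = μ Set.univ * μ Set.univ := by
  have h1 : MeasurableSet {p : α × α | f p.1 < f p.2} :=
    measurableSet_lt (hf.comp measurable_fst) (hf.comp measurable_snd)
  have h2 : MeasurableSet {p : α × α | f p.2 = f p.1} :=
    measurableSet_eq_fun (hf.comp measurable_snd) (hf.comp measurable_fst)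
  have h3 : MeasurableSet {p : α × α | f p.2 < f p.1} :=
    measurableSet_lt (hf.comp measurable_snd) (hf.comp measurable_fst)
  have e1 : ∫⁻ y, μ {z | f y < f z} ∂μ = μ.prod μ {p : α × α | f p.1 < f p.2} :=
    (Measure.prod_apply h1).symm
  have e2 : ∫⁻ y, μ {z | f z = f y} ∂μ = μ.prod μ {p : α × α | f p.2 = f p.1} :=
    (Measure.prod_apply h2).symm
  have e3 : μ.prod μ {p : α × α | f p.1 < f p.2} = μ.prod μ {p : α × α | f p.2 < f p.1} := by
    rw [Measure.prod_apply_symm h1, Measure.prod_apply h3]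
    rfl
  have m1 : Measurable fun y => μ {z | f y < f z} := measurable_measure_prodMk_left h1
  have m2 : Measurable fun y => μ {z | f z = f y} := measurable_measure_prodMk_left h2
  rw [lintegral_add_right _ m2, lintegral_const_mul _ m1, e1, e2, two_mul]
  nth_rewrite 2 [e3]
  rw [add_assoc, ← measure_union _ h2, ← measure_union _ (h3.union h2),
    ← Measure.prod_prod, Set.univ_prod_univ]
  · congr 1
    ext p
    simp only [Set.mem_union, Set.mem_ofPred_eq, Set.mem_univ, iff_true]
    rcases lt_trichotomy (f p.1) (f p.2) with h | h | h <;> simp [h]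
  · rw [Set.disjoint_left]
    rintro p (hp : f p.1 < f p.2) ((hq : f p.2 < f p.1) | (hq : f p.2 = f p.1))
    · exact lt_asymm hp hq
    · exact hp.ne' hq
  · rw [Set.disjoint_left]
    intro p (hp : f p.2 < f p.1) (hq : f p.2 = f p.1)
    exact hp.ne hq

variable {S : Type*} [MetricSpace S] [MeasurableSpace S]

/-- The density of `K12 θ x` with respect to `θ`. -/
noncomputable def nearerDensity (θ : Measure S) (x y : S) : ℝ≥0∞ :=
  2 * θ {z | dist x y < dist x z} + θ {z | dist x z = dist x y}

variable [BorelSpace S] [SecondCountableTopology S]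

theorem measurable_nearerDensity (θ : Measure S) [SFinite θ] :
    Measurable (Function.uncurry (nearerDensity θ)) := by
  have h1 : MeasurableSet {p : (S × S) × S | dist p.1.1 p.1.2 < dist p.1.1 p.2} :=
    measurableSet_lt (by fun_prop) (by fun_prop)
  have h2 : MeasurableSet {p : (S × S) × S | dist p.1.1 p.2 = dist p.1.1 p.1.2} :=
    measurableSet_eq_fun (by fun_prop) (by fun_prop)
  exact ((measurable_measure_prodMk_left h1).const_mul 2).add (measurable_measure_prodMk_left h2)

theorem measurable_nearerDensity_right (θ : Measure S) [SFinite θ] (x : S) :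
    Measurable (nearerDensity θ x) :=
  (measurable_nearerDensity θ).comp measurable_prodMk_left

theorem measurable_nearerDensity_left (θ : Measure S) [SFinite θ] (y : S) :
    Measurable fun x => nearerDensity θ x y :=
  (measurable_nearerDensity θ).comp measurable_prodMk_right

/-- Under `θ`, the density takes values at most `s` with probability at most `s`. -/
theorem measure_nearerDensity_le (θ : Measure S) [IsFiniteMeasure θ] (x : S) (s : ℝ≥0∞) :
    θ {y | nearerDensity θ x y ≤ s} ≤ s := by
  set B := {y | nearerDensity θ x y ≤ s}
  have hB : MeasurableSet B := measurableSet_le (measurable_nearerDensity_right θ x) measurable_const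
  have key : θ B * θ B ≤ s * θ B := calc
    θ B * θ B = ∫⁻ y in B, (2 * θ.restrict B {z | dist x y < dist x z}
          + θ.restrict B {z | dist x z = dist x y}) ∂θ := by
        rw [lintegral_two_mul_measure_lt_add_measure_eq (θ.restrict B) (f := dist x) (by fun_prop)]
        simp
    _ ≤ ∫⁻ y in B, nearerDensity θ x y ∂θ := by
        refine lintegral_mono fun y => ?_
        exact add_le_add (mul_le_mul_right (Measure.restrict_apply_le _ _) _)
          (Measure.restrict_apply_le _ _)
    _ ≤ ∫⁻ _ in B, s ∂θ := setLIntegral_mono measurable_const fun y hy => hy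
    _ = s * θ B := by simp
  rcases eq_or_ne (θ B) 0 with h | h
  · simp [h]
  · exact (ENNReal.mul_le_mul_iff_left h (measure_ne_top _ _)).1 key

/-- The Markov kernel `x ↦ K12 θ x`. -/
noncomputable def nearerKernel (θ : Measure S) [SFinite θ] : Kernel S S :=
  (Kernel.const S θ).withDensity (nearerDensity θ)

theorem nearerKernel_eq (θ : Measure S) [SFinite θ] (x : S) :
    nearerKernel θ x = θ.withDensity (nearerDensity θ x) := by
  rw [nearerKernel, Kernel.withDensity_apply _ (measurable_nearerDensity θ), Kernel.const_apply]

theorem nearerKernel_apply (θ : Measure S) [SFinite θ] (x : S) {A : Set S}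
    (hA : MeasurableSet A) : nearerKernel θ x A = K12 θ x A := by
  rw [nearerKernel_eq, withDensity_apply _ hA]
  rfl

instance (θ : Measure S) [IsProbabilityMeasure θ] : IsMarkovKernel (nearerKernel θ) := by
  refine ⟨fun x => ⟨?_⟩⟩
  rw [nearerKernel_apply θ x MeasurableSet.univ, K12, Measure.restrict_univ,
    lintegral_two_mul_measure_lt_add_measure_eq θ (f := dist x) (by fun_prop)]
  simp

/-- A lower bound, uniform in the starting point, for the density of two steps. -/
noncomputable def twoStepBound (θ : Measure S) (z : S) : ℝ≥0∞ :=
  4⁻¹ * 4⁻¹ * (θ {y | 4⁻¹ < nearerDensity θ y z} - 4⁻¹)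

theorem measurableSet_lt_nearerDensity (θ : Measure S) [SFinite θ] :
    MeasurableSet {p : S × S | 4⁻¹ < nearerDensity θ p.1 p.2} :=
  measurableSet_lt measurable_const (measurable_nearerDensity θ)

theorem measurable_measure_lt_nearerDensity (θ : Measure S) [SFinite θ] :
    Measurable fun z => θ {y | 4⁻¹ < nearerDensity θ y z} :=
  measurable_measure_prodMk_right (measurableSet_lt_nearerDensity θ)

theorem withDensity_twoStepBound_ne_zero (θ : Measure S) [IsProbabilityMeasure θ] :
    θ.withDensity (twoStepBound θ) ≠ 0 := by
  have hm := measurable_measure_lt_nearerDensity θ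
  have hswap : ∫⁻ z, θ {y | 4⁻¹ < nearerDensity θ y z} ∂θ
      = ∫⁻ y, θ {z | 4⁻¹ < nearerDensity θ y z} ∂θ :=
    (Measure.prod_apply_symm (measurableSet_lt_nearerDensity θ)).symm.trans
      (Measure.prod_apply (measurableSet_lt_nearerDensity θ))
  have hge : ∀ y, 1 - 4⁻¹ ≤ θ {z | 4⁻¹ < nearerDensity θ y z} := fun y => by
    have hc : {z | 4⁻¹ < nearerDensity θ y z} = {z | nearerDensity θ y z ≤ 4⁻¹}ᶜ := by
      ext z
      simp only [Set.mem_ofPred_eq, Set.mem_compl_iff, not_le]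
    rw [hc, prob_compl_eq_one_sub
      (measurableSet_le (measurable_nearerDensity_right θ y) measurable_const)]
    exact tsub_le_tsub_left (measure_nearerDensity_le θ y _) _
  have hint : 1 - 4⁻¹ - 4⁻¹ ≤ ∫⁻ z, (θ {y | 4⁻¹ < nearerDensity θ y z} - 4⁻¹) ∂θ := calc
    (1 - 4⁻¹ - 4⁻¹ : ℝ≥0∞) ≤ ∫⁻ z, θ {y | 4⁻¹ < nearerDensity θ y z} ∂θ - ∫⁻ _, 4⁻¹ ∂θ := by
        rw [hswap]
        refine tsub_le_tsub ?_ (by simp)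
        simpa using lintegral_mono (μ := θ) hge
    _ ≤ _ := lintegral_sub_le _ _ measurable_const
  have hpos : (0 : ℝ≥0∞) < 1 - 4⁻¹ - 4⁻¹ := by
    rw [tsub_pos_iff_lt, lt_tsub_iff_right, ← two_mul,
      ← ENNReal.toReal_lt_toReal (by finiteness) (by finiteness)]
    norm_num
  intro h
  have h0 := congrArg (fun μ : Measure S => μ Set.univ) h
  simp only [withDensity_apply _ MeasurableSet.univ, Measure.restrict_univ,
    Measure.coe_zero, Pi.zero_apply, twoStepBound] at h0
  rw [lintegral_const_mul _ (hm.sub_const _)] at h0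
  have h4 : (4⁻¹ * 4⁻¹ : ℝ≥0∞) ≠ 0 := by simp
  exact (hpos.trans_le hint).ne' ((mul_eq_zero.1 h0).resolve_left h4)

theorem twoStepBound_le (θ : Measure S) [IsProbabilityMeasure θ] (x z : S) :
    twoStepBound θ z ≤ ∫⁻ y, nearerDensity θ x y * nearerDensity θ y z ∂θ := by
  set D := {y | 4⁻¹ < nearerDensity θ y z} \ {y | nearerDensity θ x y ≤ 4⁻¹}
  calc twoStepBound θ z ≤ 4⁻¹ * 4⁻¹ * θ D := by
        refine mul_le_mul_right ?_ _
        exact (tsub_le_tsub_left (measure_nearerDensity_le θ x _) _).trans le_measure_sdiff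
    _ = ∫⁻ _ in D, 4⁻¹ * 4⁻¹ ∂θ := by simp
    _ ≤ ∫⁻ y in D, nearerDensity θ x y * nearerDensity θ y z ∂θ := by
        refine setLIntegral_mono ((measurable_nearerDensity_right θ x).mul
          (measurable_nearerDensity_left θ z)) fun y hy => ?_
        exact mul_le_mul' (not_le.1 hy.2).le (le_of_lt hy.1)
    _ ≤ _ := setLIntegral_le_lintegral _ _

theorem withDensity_twoStepBound_le (θ : Measure S) [IsProbabilityMeasure θ] (x : S) :
    θ.withDensity (twoStepBound θ) ≤ (nearerKernel θ ∘ₖ nearerKernel θ) x := by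
  have hm := measurable_nearerDensity θ
  refine Measure.le_iff.2 fun s hs => ?_
  rw [Kernel.comp_apply' _ _ _ hs, nearerKernel_eq, withDensity_apply _ hs,
    lintegral_withDensity_eq_lintegral_mul _ (measurable_nearerDensity_right θ x)
      (Kernel.measurable_coe _ hs)]
  simp only [nearerKernel_eq, withDensity_apply _ hs, Pi.mul_apply]
  calc ∫⁻ z in s, twoStepBound θ z ∂θ
      ≤ ∫⁻ z in s, ∫⁻ y, nearerDensity θ x y * nearerDensity θ y z ∂θ ∂θ :=
        lintegral_mono fun z => twoStepBound_le θ x z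
    _ = ∫⁻ y, ∫⁻ z in s, nearerDensity θ x y * nearerDensity θ y z ∂θ ∂θ := by
        refine lintegral_lintegral_swap (Measurable.aemeasurable ?_)
        exact ((measurable_nearerDensity_right θ x).comp measurable_snd).mul
          (hm.comp measurable_swap)
    _ = _ := by
        refine lintegral_congr fun y => ?_
        exact lintegral_const_mul _ (measurable_nearerDensity_right θ y)

end Nearer

theorem stmt_3 {S : Type*} [MetricSpace S] [CompactSpace S] [MeasurableSpace S] [BorelSpace S]
    (θ : Measure S) [IsProbabilityMeasure θ] :
    ∃! π : Measure S, IsProbabilityMeasure π ∧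
      ∀ A : Set S, MeasurableSet A → π A = ∫⁻ x, K12 θ x A ∂π := by
  have : Nonempty S := nonempty_of_isProbabilityMeasure θ
  have hiff : ∀ π : Measure S, (nearerKernel θ).Invariant π ↔
      ∀ A : Set S, MeasurableSet A → π A = ∫⁻ x, K12 θ x A ∂π := fun π => by
    rw [Kernel.Invariant, eq_comm, Measure.ext_iff]
    refine forall₂_congr fun A hA => ?_
    rw [Measure.bind_apply hA (Kernel.aemeasurable _)]
    simp_rw [nearerKernel_apply θ _ hA]
  simp_rw [← hiff]
  exact existsUnique_invariant_of_comp_self_minorization (nearerKernel θ) _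
    (withDensity_twoStepBound_ne_zero θ) (withDensity_twoStepBound_le θ)
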